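/- (Total correctness of ⟦P⟧ in the Lolli model.) Let Q be the loop program while ((*1) > 0) do (0 ← *0 + *1 ; 1 ← *1 − 1) and, for N ∈ ℕ, let P be the program 0 ← 0 ; (1 ← N ; Q) of the imperative language ℒ. For all N₁, N₂ ∈ ℕ, every memory M₀, and M = M₀[0↦N₂][1↦N₁], there exists N₃ ∈ ℕ such that the sequent Γ_e ; ⟦M⟧ ⊢ e ⟦P⟧ ⌜0⌝ ((m ⌜0⌝ ⌜N₃⌝) ⊗ ⊤) is provable in Lolli and N₃ = ∑_{i=0}^{N} i. -/

import Mathlib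

/-- Programs of the imperative language ℒ, which also serve as the closed
terms of type ℝ of the first-order specification language (the homomorphic
translation `⟦·⟧` via the constructors `v, add, sub, gt, get, set, seq, wh`
is then the identity). -/
inductive Prog : Type
  | num : ℕ → Prog            -- `v N`
  | add : Prog → Prog → Prog
  | sub : Prog → Prog → Prog
  | gt : Prog → Prog → Prog
  | deref : Prog → Prog       -- `get`
  | assign : Prog → Prog → Prog  -- `set`
  | seq : Prog → Prog → Prog
  | whileDo : Prog → Prog → Prog -- `wh`

mutual

/-- Atomic formulas: the memory predicate `m : ℕ → ℕ → o`, the evaluation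
predicate `e : ℝ → ℕ → o → o` (whose last argument is a goal formula, the
continuation), and the arithmetic equality/comparison atoms on ℕ. -/
inductive LAtom : Type
  | m : ℕ → ℕ → LAtom
  | e : Prog → ℕ → LGoal → LAtom
  | eq : ℕ → ℕ → LAtom
  | gt : ℕ → ℕ → LAtom
  | le : ℕ → ℕ → LAtom

/-- Program clause formulas of Lolli over these atoms. -/
inductive LClause : Type
  | atom : LAtom → LClause
  | conj : LClause → LClause → LClause
  | limp : LGoal → LClause → LClause   -- `G ⊸ P`
  | imp  : LGoal → LClause → LClause   -- `G ⇒ P`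

/-- Goal formulas of Lolli over these atoms. -/
inductive LGoal : Type
  | top  : LGoal
  | atom : LAtom → LGoal
  | conj : LGoal → LGoal → LGoal
  | limp : LClause → LGoal → LGoal     -- `P ⊸ G`
  | imp  : LClause → LGoal → LGoal     -- `P ⇒ G`
  | bang : LGoal → LGoal
  | tensor : LGoal → LGoal → LGoal
  | oplus  : LGoal → LGoal → LGoal

end

/-- Provability of the Lolli sequent `Γ ; Δ ⊢ G`.  The arithmetic atoms are
interpreted standardly: a true arithmetic atom is provable (from no bounded
resources). -/
inductive LProv : Set LClause → Multiset LClause → LGoal → Prop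
  | id (Γ : Set LClause) (a : LAtom) : LProv Γ {LClause.atom a} (LGoal.atom a)
  | absorb {Γ Δ G} {B : LClause} : B ∈ Γ → LProv Γ (B ::ₘ Δ) G → LProv Γ Δ G
  | topR (Γ : Set LClause) (Δ : Multiset LClause) : LProv Γ Δ LGoal.top
  | conjL₁ {Γ Δ G} {B₁ B₂ : LClause} :
      LProv Γ (B₁ ::ₘ Δ) G → LProv Γ (LClause.conj B₁ B₂ ::ₘ Δ) G
  | conjL₂ {Γ Δ G} {B₁ B₂ : LClause} :
      LProv Γ (B₂ ::ₘ Δ) G → LProv Γ (LClause.conj B₁ B₂ ::ₘ Δ) G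
  | conjR {Γ Δ} {G₁ G₂ : LGoal} :
      LProv Γ Δ G₁ → LProv Γ Δ G₂ → LProv Γ Δ (LGoal.conj G₁ G₂)
  | limpL {Γ Δ₁ Δ₂ G} {G₁ : LGoal} {B₂ : LClause} :
      LProv Γ Δ₁ G₁ → LProv Γ (B₂ ::ₘ Δ₂) G →
      LProv Γ (LClause.limp G₁ B₂ ::ₘ (Δ₁ + Δ₂)) G
  | limpR {Γ Δ} {B : LClause} {G : LGoal} :
      LProv Γ (B ::ₘ Δ) G → LProv Γ Δ (LGoal.limp B G)
  | impL {Γ Δ G} {G₁ : LGoal} {B₂ : LClause} :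
      LProv Γ 0 G₁ → LProv Γ (B₂ ::ₘ Δ) G → LProv Γ (LClause.imp G₁ B₂ ::ₘ Δ) G
  | impR {Γ Δ} {B : LClause} {G : LGoal} :
      LProv (insert B Γ) Δ G → LProv Γ Δ (LGoal.imp B G)
  | bangR {Γ} {G : LGoal} : LProv Γ 0 G → LProv Γ 0 (LGoal.bang G)
  | oplusR₁ {Γ Δ} {G₁ G₂ : LGoal} : LProv Γ Δ G₁ → LProv Γ Δ (LGoal.oplus G₁ G₂)
  | oplusR₂ {Γ Δ} {G₁ G₂ : LGoal} : LProv Γ Δ G₂ → LProv Γ Δ (LGoal.oplus G₁ G₂)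
  | tensorR {Γ Δ₁ Δ₂} {G₁ G₂ : LGoal} :
      LProv Γ Δ₁ G₁ → LProv Γ Δ₂ G₂ → LProv Γ (Δ₁ + Δ₂) (LGoal.tensor G₁ G₂)
  | eqR {Γ : Set LClause} {n₁ n₂ : ℕ} :
      n₁ = n₂ → LProv Γ 0 (LGoal.atom (LAtom.eq n₁ n₂))
  | gtR {Γ : Set LClause} {n₁ n₂ : ℕ} :
      n₁ > n₂ → LProv Γ 0 (LGoal.atom (LAtom.gt n₁ n₂))
  | leR {Γ : Set LClause} {n₁ n₂ : ℕ} :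
      n₁ ≤ n₂ → LProv Γ 0 (LGoal.atom (LAtom.le n₁ n₂))

/-- The set `Γ_e` of (all instances of the universally closed) program clauses
modeling the evaluation semantics of ℒ; universal quantification over the
variables `E, E₁, E₂ : ℝ`, `N, N₁, N₂, N₃ : ℕ` and `C : o` of each clause is
rendered by taking all of its instances. -/
inductive GammaE : LClause → Prop
  | val (N : ℕ) (C : LGoal) :
      GammaE (LClause.limp C (LClause.atom (LAtom.e (Prog.num N) N C)))
  | add (E₁ E₂ : Prog) (N₁ N₂ N₃ : ℕ) (C : LGoal) :
      GammaE (LClause.limp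
        (LGoal.atom (LAtom.e E₁ N₁ (LGoal.atom (LAtom.e E₂ N₂
          (LGoal.tensor (LGoal.atom (LAtom.eq N₃ (N₁ + N₂))) C)))))
        (LClause.atom (LAtom.e (Prog.add E₁ E₂) N₃ C)))
  | sub (E₁ E₂ : Prog) (N₁ N₂ N₃ : ℕ) (C : LGoal) :
      GammaE (LClause.limp
        (LGoal.atom (LAtom.e E₁ N₁ (LGoal.atom (LAtom.e E₂ N₂
          (LGoal.tensor (LGoal.atom (LAtom.eq N₃ (N₁ - N₂))) C)))))
        (LClause.atom (LAtom.e (Prog.sub E₁ E₂) N₃ C)))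
  | gt_true (E₁ E₂ : Prog) (N₁ N₂ : ℕ) (C : LGoal) :
      GammaE (LClause.limp
        (LGoal.atom (LAtom.e E₁ N₁ (LGoal.atom (LAtom.e E₂ N₂
          (LGoal.tensor (LGoal.atom (LAtom.gt N₁ N₂)) C)))))
        (LClause.atom (LAtom.e (Prog.gt E₁ E₂) 1 C)))
  | gt_false (E₁ E₂ : Prog) (N₁ N₂ : ℕ) (C : LGoal) :
      GammaE (LClause.limp
        (LGoal.atom (LAtom.e E₁ N₁ (LGoal.atom (LAtom.e E₂ N₂
          (LGoal.tensor (LGoal.atom (LAtom.le N₁ N₂)) C)))))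
        (LClause.atom (LAtom.e (Prog.gt E₁ E₂) 0 C)))
  | get (E : Prog) (N₁ N₂ : ℕ) (C : LGoal) :
      GammaE (LClause.limp
        (LGoal.atom (LAtom.e E N₁
          (LGoal.tensor (LGoal.atom (LAtom.m N₁ N₂))
            (LGoal.limp (LClause.atom (LAtom.m N₁ N₂)) C))))
        (LClause.atom (LAtom.e (Prog.deref E) N₂ C)))
  | set (E₁ E₂ : Prog) (N₁ N₂ N₃ : ℕ) (C : LGoal) :
      GammaE (LClause.limp
        (LGoal.atom (LAtom.e E₁ N₁ (LGoal.atom (LAtom.e E₂ N₂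
          (LGoal.tensor (LGoal.atom (LAtom.m N₁ N₃))
            (LGoal.limp (LClause.atom (LAtom.m N₁ N₂)) C))))))
        (LClause.atom (LAtom.e (Prog.assign E₁ E₂) N₂ C)))
  | seq (E₁ E₂ : Prog) (N₁ N₂ : ℕ) (C : LGoal) :
      GammaE (LClause.limp
        (LGoal.atom (LAtom.e E₁ N₁ (LGoal.atom (LAtom.e E₂ N₂ C))))
        (LClause.atom (LAtom.e (Prog.seq E₁ E₂) N₂ C)))
  | wh_true (E₁ E₂ : Prog) (N₁ N₂ : ℕ) (C : LGoal) :
      GammaE (LClause.limp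
        (LGoal.tensor
          (LGoal.atom (LAtom.e E₁ N₁ (LGoal.atom (LAtom.e E₂ N₂
            (LGoal.atom (LAtom.e (Prog.whileDo E₁ E₂) 0 C))))))
          (LGoal.atom (LAtom.gt N₁ 0)))
        (LClause.atom (LAtom.e (Prog.whileDo E₁ E₂) 0 C)))
  | wh_false (E₁ E₂ : Prog) (N₁ : ℕ) (C : LGoal) :
      GammaE (LClause.limp
        (LGoal.tensor (LGoal.atom (LAtom.e E₁ N₁ C))
          (LGoal.atom (LAtom.eq N₁ 0)))
        (LClause.atom (LAtom.e (Prog.whileDo E₁ E₂) 0 C)))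

/-- A memory: a partial function from ℕ to ℕ (with finite domain, so that its
translation is a multiset). -/
def LMem : Type := Finmap fun _ : ℕ => ℕ

/-- The translation `⟦M⟧` of a memory `M`: the multiset `{ m l v : M(l) = v }`. -/
def memT (M : LMem) : Multiset LClause :=
  M.entries.map fun s => LClause.atom (LAtom.m s.1 s.2)

/-- The memory update `M[x ↦ y]`. -/
def LMem.update (M : LMem) (x y : ℕ) : LMem := Finmap.insert x y M

/-- The summation loop `Q = while ((*1) > 0) do (0 ← *0 + *1 ; 1 ← *1 − 1)`
(equivalently, its translation `⟦Q⟧` as a term of type ℝ). -/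
def progQ : Prog :=
  Prog.whileDo (Prog.gt (Prog.deref (Prog.num 1)) (Prog.num 0))
    (Prog.seq
      (Prog.assign (Prog.num 0) (Prog.add (Prog.deref (Prog.num 0)) (Prog.deref (Prog.num 1))))
      (Prog.assign (Prog.num 1) (Prog.sub (Prog.deref (Prog.num 1)) (Prog.num 1))))

/-- The summation program `P = 0 ← 0 ; (1 ← N ; Q)` (equivalently, its
translation `⟦P⟧` as a term of type ℝ). -/
def progP (N : ℕ) : Prog :=
  Prog.seq (Prog.assign (Prog.num 0) (Prog.num 0))
    (Prog.seq (Prog.assign (Prog.num 1) (Prog.num N)) progQ)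

/-- Backchaining on an instance of a clause of `Γ_e`. -/
theorem LProv.backchain {Δ : Multiset LClause} {G : LGoal} {a : LAtom}
    (hc : GammaE (LClause.limp G (LClause.atom a))) (h : LProv {p | GammaE p} Δ G) :
    LProv {p | GammaE p} Δ (LGoal.atom a) := by
  refine LProv.absorb (B := LClause.limp G (LClause.atom a)) hc ?_
  simpa using LProv.limpL h (LProv.id {p | GammaE p} a)

/-- Proving a tensor whose left factor needs no bounded resources. -/
theorem LProv.tensor_left_empty {Γ : Set LClause} {Δ : Multiset LClause} {G₁ G₂ : LGoal}
    (h₁ : LProv Γ 0 G₁) (h₂ : LProv Γ Δ G₂) : LProv Γ Δ (LGoal.tensor G₁ G₂) := by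
  simpa using LProv.tensorR h₁ h₂

/-- Proving a tensor whose right factor needs no bounded resources. -/
theorem LProv.tensor_right_empty {Γ : Set LClause} {Δ : Multiset LClause} {G₁ G₂ : LGoal}
    (h₁ : LProv Γ Δ G₁) (h₂ : LProv Γ 0 G₂) : LProv Γ Δ (LGoal.tensor G₁ G₂) := by
  simpa using LProv.tensorR h₁ h₂

/-- Consuming a bounded atom to prove the left factor of a tensor. -/
theorem LProv.tensor_atom {Γ : Set LClause} {Δ : Multiset LClause} {a : LAtom} {G : LGoal}
    (h : LProv Γ Δ G) : LProv Γ (LClause.atom a ::ₘ Δ) (LGoal.tensor (LGoal.atom a) G) := by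
  simpa using LProv.tensorR (LProv.id Γ a) h

theorem LProv.eval_num {Δ : Multiset LClause} {C : LGoal} (n : ℕ)
    (h : LProv {p | GammaE p} Δ C) :
    LProv {p | GammaE p} Δ (LGoal.atom (LAtom.e (Prog.num n) n C)) :=
  LProv.backchain (GammaE.val n C) h

/-- Reading a location holding `v`. -/
theorem LProv.eval_deref_num {Δ : Multiset LClause} {C : LGoal} {l v : ℕ}
    (hm : LClause.atom (LAtom.m l v) ∈ Δ) (h : LProv {p | GammaE p} Δ C) :
    LProv {p | GammaE p} Δ (LGoal.atom (LAtom.e (Prog.deref (Prog.num l)) v C)) := by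
  obtain ⟨Δ₁, rfl⟩ := Multiset.exists_cons_of_mem hm
  exact LProv.backchain (GammaE.get _ l v C) (LProv.eval_num l (LProv.tensor_atom h.limpR))

/-- The two final steps of an assignment: the old content of the location is
consumed and the new one is produced. -/
theorem LProv.store {Γ : Set LClause} {Δ : Multiset LClause} {C : LGoal} {l old new : ℕ}
    (h : LProv Γ (LClause.atom (LAtom.m l new) ::ₘ Δ) C) :
    LProv Γ (LClause.atom (LAtom.m l old) ::ₘ Δ)
      (LGoal.tensor (LGoal.atom (LAtom.m l old))
        (LGoal.limp (LClause.atom (LAtom.m l new)) C)) :=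
  LProv.tensor_atom h.limpR

/-- The loop guard `*1 > 0` evaluates to `1` when location `1` is positive. -/
theorem LProv.eval_guard_pos {Δ : Multiset LClause} {C : LGoal} {k : ℕ} (hk : 0 < k)
    (hm : LClause.atom (LAtom.m 1 k) ∈ Δ) (h : LProv {p | GammaE p} Δ C) :
    LProv {p | GammaE p} Δ
      (LGoal.atom (LAtom.e (Prog.gt (Prog.deref (Prog.num 1)) (Prog.num 0)) 1 C)) :=
  LProv.backchain (GammaE.gt_true _ _ k 0 C)
    (LProv.eval_deref_num hm (LProv.eval_num 0 (LProv.tensor_left_empty (LProv.gtR hk) h)))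

/-- The loop guard `*1 > 0` evaluates to `0` when location `1` holds `0`. -/
theorem LProv.eval_guard_zero {Δ : Multiset LClause} {C : LGoal}
    (hm : LClause.atom (LAtom.m 1 0) ∈ Δ) (h : LProv {p | GammaE p} Δ C) :
    LProv {p | GammaE p} Δ
      (LGoal.atom (LAtom.e (Prog.gt (Prog.deref (Prog.num 1)) (Prog.num 0)) 0 C)) :=
  LProv.backchain (GammaE.gt_false _ _ 0 0 C)
    (LProv.eval_deref_num hm
      (LProv.eval_num 0 (LProv.tensor_left_empty (LProv.leR le_rfl) h)))

/-- Evaluation of the loop body `0 ← *0 + *1 ; 1 ← *1 − 1`. -/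
theorem LProv.eval_body {Δ : Multiset LClause} {C : LGoal} {s k : ℕ}
    (h : LProv {p | GammaE p}
      (LClause.atom (LAtom.m 0 (s + k)) ::ₘ LClause.atom (LAtom.m 1 (k - 1)) ::ₘ Δ) C) :
    LProv {p | GammaE p} (LClause.atom (LAtom.m 0 s) ::ₘ LClause.atom (LAtom.m 1 k) ::ₘ Δ)
      (LGoal.atom (LAtom.e
        (Prog.seq
          (Prog.assign (Prog.num 0)
            (Prog.add (Prog.deref (Prog.num 0)) (Prog.deref (Prog.num 1))))
          (Prog.assign (Prog.num 1) (Prog.sub (Prog.deref (Prog.num 1)) (Prog.num 1))))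
        (k - 1) C)) := by
  refine LProv.backchain (GammaE.seq _ _ (s + k) (k - 1) C) ?_
  refine LProv.backchain (GammaE.set _ _ 0 (s + k) s _) (LProv.eval_num 0 ?_)
  refine LProv.backchain (GammaE.add _ _ s k (s + k) _) ?_
  refine LProv.eval_deref_num (by simp) (LProv.eval_deref_num (by simp) ?_)
  refine LProv.tensor_left_empty (LProv.eqR rfl) (LProv.store ?_)
  refine LProv.backchain (GammaE.set _ _ 1 (k - 1) k _) (LProv.eval_num 1 ?_)
  refine LProv.backchain (GammaE.sub _ _ k 1 (k - 1) _) ?_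
  refine LProv.eval_deref_num (by simp) (LProv.eval_num 1 ?_)
  refine LProv.tensor_left_empty (LProv.eqR rfl) ?_
  rw [Multiset.cons_swap] at h ⊢
  exact LProv.store h

/-- The loop adds `∑_{i=0}^{k} i` to location `0` when location `1` holds `k`. -/
theorem LProv.eval_progQ {Δ : Multiset LClause} {C : LGoal} (k s : ℕ)
    (h : LProv {p | GammaE p}
      (LClause.atom (LAtom.m 0 (s + ∑ i ∈ Finset.range (k + 1), i)) ::ₘ
        LClause.atom (LAtom.m 1 0) ::ₘ Δ) C) :
    LProv {p | GammaE p} (LClause.atom (LAtom.m 0 s) ::ₘ LClause.atom (LAtom.m 1 k) ::ₘ Δ)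
      (LGoal.atom (LAtom.e progQ 0 C)) := by
  induction k generalizing s with
  | zero =>
    refine LProv.backchain (GammaE.wh_false _ _ 0 C) ?_
    refine LProv.tensor_right_empty (LProv.eval_guard_zero (by simp) ?_) (LProv.eqR rfl)
    simpa using h
  | succ k ih =>
    refine LProv.backchain (GammaE.wh_true _ _ 1 k C) ?_
    refine LProv.tensor_right_empty
      (LProv.eval_guard_pos k.succ_pos (by simp) (LProv.eval_body ?_)) (LProv.gtR one_pos)
    refine ih (s + (k + 1)) ?_
    rwa [Finset.sum_range_succ, add_comm (∑ i ∈ Finset.range (k + 1), i), ← add_assoc] at h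

theorem mem_memT_of_lookup {M : LMem} {l v : ℕ} (h : Finmap.lookup l M = some v) :
    LClause.atom (LAtom.m l v) ∈ memT M :=
  Multiset.mem_map_of_mem (fun s : Sigma fun _ : ℕ => ℕ => LClause.atom (LAtom.m s.1 s.2))
    (Finmap.lookup_eq_some_iff.mp h)

/-- The memory `M₀[0 ↦ y][1 ↦ x]` holds `y` at `0` and `x` at `1`. -/
theorem exists_memT_update_eq_cons (M₀ : LMem) (x y : ℕ) :
    ∃ Δ : Multiset LClause, memT ((M₀.update 0 y).update 1 x) =
      LClause.atom (LAtom.m 0 y) ::ₘ LClause.atom (LAtom.m 1 x) ::ₘ Δ := by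
  have h₀ : LClause.atom (LAtom.m 0 y) ∈ memT ((M₀.update 0 y).update 1 x) :=
    mem_memT_of_lookup ((Finmap.lookup_insert_of_ne _ zero_ne_one).trans
      (Finmap.lookup_insert M₀))
  have h₁ : LClause.atom (LAtom.m 1 x) ∈ memT ((M₀.update 0 y).update 1 x) :=
    mem_memT_of_lookup (Finmap.lookup_insert _)
  obtain ⟨Δ, hΔ⟩ := Multiset.exists_cons_of_mem h₀
  rw [hΔ] at h₁ ⊢
  obtain ⟨Δ₁, rfl⟩ := Multiset.exists_cons_of_mem
    ((Multiset.mem_cons.mp h₁).resolve_left (by simp))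
  exact ⟨Δ₁, rfl⟩

/-- **Total correctness of `⟦P⟧` in the Lolli model**: for every `N ∈ ℕ`, all
`N₁, N₂ ∈ ℕ`, every memory `M₀` and `M = M₀[0↦N₂][1↦N₁]`, there is an
`N₃ ∈ ℕ` such that the sequent `Γ_e ; ⟦M⟧ ⊢ e ⟦P⟧ ⌜0⌝ ((m ⌜0⌝ ⌜N₃⌝) ⊗ ⊤)` is
provable in Lolli and `N₃ = ∑_{i=0}^{N} i`. -/
theorem progP_total_correctness_model (N N₁ N₂ : ℕ) (M₀ : LMem) :
    ∃ N₃ : ℕ,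
      LProv {p | GammaE p} (memT ((M₀.update 0 N₂).update 1 N₁))
        (LGoal.atom (LAtom.e (progP N) 0
          (LGoal.tensor (LGoal.atom (LAtom.m 0 N₃)) LGoal.top))) ∧
      N₃ = ∑ i ∈ Finset.range (N + 1), i := by
  obtain ⟨Δ, hΔ⟩ := exists_memT_update_eq_cons M₀ N₁ N₂
  refine ⟨_, ?_, rfl⟩
  rw [hΔ]
  refine LProv.backchain (GammaE.seq _ _ 0 0 _) ?_
  refine LProv.backchain (GammaE.set _ _ 0 0 N₂ _) ?_
  refine LProv.eval_num 0 (LProv.eval_num 0 (LProv.store ?_))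
  refine LProv.backchain (GammaE.seq _ _ N 0 _) ?_
  refine LProv.backchain (GammaE.set _ _ 1 N N₁ _) ?_
  refine LProv.eval_num 1 (LProv.eval_num N ?_)
  rw [Multiset.cons_swap]
  refine LProv.store ?_
  rw [Multiset.cons_swap]
  refine LProv.eval_progQ N 0 ?_
  rw [zero_add]
  exact LProv.tensor_atom (LProv.topR _ _)
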